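/- The Hilbert system obtained from the base logic by replacing axiom schema B1 with its unrestricted counterpart (C_G) (□_Gφ ∧ □_Hψ) → □_{G∪H}(φ∧ψ) for all finite nonempty G, H ⊆ I (no disjointness requirement) is sound and strongly complete with respect to the class of all models in which each N_i(w) is closed under arbitrary intersections: for every nonempty family 𝒴 ⊆ N_i(w), ⋂𝒴 ∈ N_i(w). -/

import Mathlib

attribute [local instance] Classical.propDecidable

/-- Formulas of the multi-modal language 𝔏: atoms, ⊥, ¬, ∨, and □_G for
finite nonempty G ⊆ I. -/
inductive Form (I : Type) : Type
  | atom : ℕ → Form I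
  | bot  : Form I
  | neg  : Form I → Form I
  | or   : Form I → Form I → Form I
  | box  : (G : Finset I) → G.Nonempty → Form I → Form I

namespace Form
variable {I : Type}
/-- φ ∧ ψ -/
def and (φ ψ : Form I) : Form I := .neg (.or (.neg φ) (.neg ψ))
/-- φ → ψ -/
def imp (φ ψ : Form I) : Form I := .or (.neg φ) ψ
/-- ⊤ -/
def top : Form I := .neg .bot
/-- φ ↔ ψ -/
def iff (φ ψ : Form I) : Form I := (φ.imp ψ).and (ψ.imp φ)
end Form

/-- The pointwise-intersection neighbourhood function:
`N_G(w) = { ⋂_{i∈G} X_i : X_i ∈ N_i(w) }`. -/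
def ptwInter {I W : Type} (N : I → W → Set (Set W)) (G : Finset I) (w : W) :
    Set (Set W) :=
  { X | ∃ Y : I → Set W, (∀ i ∈ G, Y i ∈ N i w) ∧ X = ⋂ i ∈ G, Y i }

/-- Satisfaction at a world, relative to neighbourhood functions `N` and a
valuation `V`. -/
def satN {I W : Type} (N : I → W → Set (Set W)) (V : ℕ → Set W) :
    Form I → W → Prop
  | .atom n, w => w ∈ V n
  | .bot, _ => False
  | .neg φ, w => ¬ satN N V φ w
  | .or φ ψ, w => satN N V φ w ∨ satN N V ψ w
  | .box G _ φ, w => { v | satN N V φ v } ∈ ptwInter N G w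

/-- A neighbourhood model. -/
structure NbhModel (I : Type) where
  W : Type
  ne : Nonempty W
  N : I → W → Set (Set W)
  V : ℕ → Set W

/-- Truth in a model. -/
def NbhModel.sat {I : Type} (M : NbhModel I) (w : M.W) (φ : Form I) : Prop :=
  satN M.N M.V φ w

/-- Propositional evaluation treating atoms and boxed formulas as atomic. -/
def evalP {I : Type} (v : Form I → Prop) : Form I → Prop
  | .atom n => v (.atom n)
  | .bot => False
  | .neg φ => ¬ evalP v φ
  | .or φ ψ => evalP v φ ∨ evalP v ψ
  | .box G h φ => v (.box G h φ)

/-- Classical propositional tautologies (in the extended modal language). -/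
def Tautology {I : Type} (φ : Form I) : Prop := ∀ v, evalP v φ

theorem unionNE {I : Type} [DecidableEq I] {G H : Finset I}
    (hG : G.Nonempty) : (G ∪ H).Nonempty :=
  hG.mono Finset.subset_union_left

/-- Axiom schema B1: `(□_Gφ ∧ □_Hψ) → □_{G∪H}(φ∧ψ)` for disjoint G, H. -/
def B1Ax (I : Type) [DecidableEq I] : Set (Form I) :=
  { χ | ∃ (G H : Finset I) (hG : G.Nonempty) (hH : H.Nonempty) (φ ψ : Form I),
      Disjoint G H ∧
      χ = ((Form.box G hG φ).and (Form.box H hH ψ)).imp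
            (Form.box (G ∪ H) (unionNE hG) (φ.and ψ)) }

/-- Axiom schema B2: `□_{G∪H}⊤ → □_G⊤`. -/
def B2Ax (I : Type) [DecidableEq I] : Set (Form I) :=
  { χ | ∃ (G H : Finset I) (hG : G.Nonempty) (_hH : H.Nonempty),
      χ = (Form.box (G ∪ H) (unionNE hG) Form.top).imp (Form.box G hG Form.top) }

/-- Axiom schema B3: `(□_Gφ ∧ □_{G∪H∪J}φ) → □_{G∪H}φ`. -/
def B3Ax (I : Type) [DecidableEq I] : Set (Form I) :=
  { χ | ∃ (G H J : Finset I) (hG : G.Nonempty) (_hH : H.Nonempty)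
      (_hJ : J.Nonempty) (φ : Form I),
      χ = ((Form.box G hG φ).and (Form.box (G ∪ H ∪ J) (unionNE (unionNE hG)) φ)).imp
            (Form.box (G ∪ H) (unionNE hG) φ) }

/-- Axiom schema B4: `(□_Gφ ∧ □_H(φ∨ψ)) → □_{G∪H}φ`. -/
def B4Ax (I : Type) [DecidableEq I] : Set (Form I) :=
  { χ | ∃ (G H : Finset I) (hG : G.Nonempty) (hH : H.Nonempty) (φ ψ : Form I),
      χ = ((Form.box G hG φ).and (Form.box H hH (φ.or ψ))).imp
            (Form.box (G ∪ H) (unionNE hG) φ) }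

/-- The axioms of the base logic. -/
def BaseAx (I : Type) [DecidableEq I] : Set (Form I) :=
  B1Ax I ∪ B2Ax I ∪ B3Ax I ∪ B4Ax I

/-- Hilbert-style provability from classical tautologies and the axioms in
`Ax`, closed under modus ponens and replacement of equivalents. -/
inductive Prv {I : Type} (Ax : Set (Form I)) : Form I → Prop
  | taut {φ : Form I} : Tautology φ → Prv Ax φ
  | ax {φ : Form I} : φ ∈ Ax → Prv Ax φ
  | mp {φ ψ : Form I} : Prv Ax (φ.imp ψ) → Prv Ax φ → Prv Ax ψ
  | re {φ ψ : Form I} (G : Finset I) (hG : G.Nonempty) :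
      Prv Ax (φ.iff ψ) → Prv Ax ((Form.box G hG φ).iff (Form.box G hG ψ))

/-- `Γ ⊢ φ` iff there are `ψ₁,…,ψₙ ∈ Γ` with `⊢ (ψ₁∧…∧ψₙ) → φ`. -/
def Deduces {I : Type} (Ax : Set (Form I)) (Γ : Set (Form I)) (φ : Form I) :
    Prop :=
  ∃ l : List (Form I), (∀ ψ ∈ l, ψ ∈ Γ) ∧
    Prv Ax ((l.foldr Form.and Form.top).imp φ)

/-- Semantic consequence over a class of models. -/
def SemConseq {I : Type} (C : NbhModel I → Prop) (Γ : Set (Form I))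
    (φ : Form I) : Prop :=
  ∀ M : NbhModel I, C M → ∀ w : M.W, (∀ ψ ∈ Γ, M.sat w ψ) → M.sat w φ

/-- Soundness and strong completeness of `Ax` w.r.t. the class `C`. -/
def SoundComplete {I : Type} (Ax : Set (Form I)) (C : NbhModel I → Prop) :
    Prop :=
  ∀ (Γ : Set (Form I)) (φ : Form I), Deduces Ax Γ φ ↔ SemConseq C Γ φ

/-- The unrestricted schema (C_G): (□_Gφ ∧ □_Hψ) → □_{G∪H}(φ∧ψ) for all
finite nonempty G, H ⊆ I (no disjointness requirement). -/
def CGAx (I : Type) [DecidableEq I] : Set (Form I) :=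
  { χ | ∃ (G H : Finset I) (hG : G.Nonempty) (hH : H.Nonempty) (φ ψ : Form I),
      χ = ((Form.box G hG φ).and (Form.box H hH ψ)).imp
            (Form.box (G ∪ H) (unionNE hG) (φ.and ψ)) }

namespace NbhLogic

variable {I : Type}

section Propositional

@[simp] theorem evalP_and (v : Form I → Prop) (φ ψ : Form I) :
    evalP v (φ.and ψ) ↔ evalP v φ ∧ evalP v ψ := by
  simp only [Form.and, evalP]; tauto

@[simp] theorem evalP_imp (v : Form I → Prop) (φ ψ : Form I) :
    evalP v (φ.imp ψ) ↔ (evalP v φ → evalP v ψ) := by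
  simp only [Form.imp, evalP]; tauto

@[simp] theorem evalP_iff (v : Form I → Prop) (φ ψ : Form I) :
    evalP v (φ.iff ψ) ↔ (evalP v φ ↔ evalP v ψ) := by
  simp only [Form.iff, evalP_and, evalP_imp]; tauto

@[simp] theorem evalP_top (v : Form I → Prop) : evalP v (Form.top : Form I) := by
  simp [Form.top, evalP]

theorem evalP_foldr_and (v : Form I → Prop) (l : List (Form I)) (χ : Form I) :
    evalP v (l.foldr Form.and χ) ↔ (∀ φ ∈ l, evalP v φ) ∧ evalP v χ := by
  induction l with
  | nil => simp
  | cons φ l ih => simp [ih, and_assoc]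

theorem isClopen_setOf_evalP (φ : Form I) :
    IsClopen {v : Form I → Bool | evalP (fun χ => v χ = true) φ} := by
  have key (χ : Form I) : IsClopen {v : Form I → Bool | v χ = true} :=
    (isClopen_discrete {true}).preimage (continuous_apply χ)
  induction φ with
  | atom n => exact key _
  | bot => exact isClopen_empty
  | neg φ ih => exact ih.compl
  | or φ ψ ih₁ ih₂ => exact ih₁.union ih₂
  | box G hG φ _ => exact key _

/-- Compactness of classical propositional consequence. -/
theorem exists_list_of_entails {S : Set (Form I)} {φ : Form I}
    (h : ∀ v, (∀ ψ ∈ S, evalP v ψ) → evalP v φ) :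
    ∃ l : List (Form I), (∀ ψ ∈ l, ψ ∈ S) ∧
      ∀ v, (∀ ψ ∈ l, evalP v ψ) → evalP v φ := by
  let c (ψ : Form I) : Set (Form I → Bool) := {v | evalP (fun χ => v χ = true) ψ}
  have hempty : (c φ)ᶜ ∩ ⋂ ψ : S, c ψ = ∅ := by
    refine Set.eq_empty_of_forall_notMem fun v hv => hv.1 (h _ fun ψ hψ => ?_)
    exact Set.mem_iInter.1 hv.2 ⟨ψ, hψ⟩
  obtain ⟨t, ht⟩ := (isClopen_setOf_evalP φ).compl.isClosed.isCompact.elim_finite_subfamily_closed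
    (fun ψ : S => c ψ) (fun ψ => (isClopen_setOf_evalP ψ.1).isClosed) hempty
  refine ⟨t.toList.map Subtype.val, ?_, fun v hv => ?_⟩
  · simp only [List.mem_map]
    rintro _ ⟨ψ, -, rfl⟩
    exact ψ.2
  · by_contra hφ
    have hb : (fun χ => decide (v χ) = true) = v := by funext χ; simp
    refine Set.eq_empty_iff_forall_notMem.1 ht (fun χ => decide (v χ)) ⟨?_, ?_⟩
    · simpa only [c, Set.mem_compl_iff, Set.mem_ofPred_eq, hb] using hφ
    · refine Set.mem_iInter₂.2 fun ψ hψ => ?_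
      simp only [c, Set.mem_ofPred_eq, hb]
      exact hv _ (List.mem_map_of_mem (Finset.mem_toList.2 hψ))

end Propositional

section Worlds

variable {Ax : Set (Form I)}

theorem deduces_of_list {Γ : Set (Form I)} (l : List (Form I))
    (hl : ∀ ψ ∈ l, ψ ∈ Γ ∨ Prv Ax ψ) (φ : Form I)
    (h : ∀ v, (∀ ψ ∈ l, evalP v ψ) → evalP v φ) : Deduces Ax Γ φ := by
  induction l generalizing φ with
  | nil => exact ⟨[], by simp, .taut fun v => by simpa using h v⟩
  | cons ψ l ih =>
    obtain ⟨l', hl', hp⟩ := ih (fun χ hχ => hl χ (List.mem_cons_of_mem _ hχ)) (ψ.imp φ)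
      fun v hv => by
        rw [evalP_imp]
        intro hψ
        exact h v (by simpa using ⟨hψ, hv⟩)
    rcases hl ψ List.mem_cons_self with hψ | hψ
    · refine ⟨ψ :: l', by simpa using ⟨hψ, hl'⟩, .mp (.taut fun v => ?_) hp⟩
      simp only [List.foldr_cons, evalP_imp, evalP_and]
      tauto
    · refine ⟨l', hl', .mp (.mp (.taut fun v => ?_) hp) hψ⟩
      simp only [evalP_imp]
      tauto

/-- Propositional valuations satisfying every theorem; these play the role of maximal
consistent sets. -/
def World (Ax : Set (Form I)) : Type :=
  {v : Form I → Prop // ∀ φ, Prv Ax φ → evalP v φ}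

/-- Membership of a formula in the maximal consistent set given by a world. -/
def World.Holds (w : World Ax) (φ : Form I) : Prop := evalP w.1 φ

theorem exists_list_of_worlds {Γ : Set (Form I)} {φ : Form I}
    (h : ∀ w : World Ax, (∀ ψ ∈ Γ, w.Holds ψ) → w.Holds φ) :
    ∃ l : List (Form I), (∀ ψ ∈ l, ψ ∈ Γ ∨ Prv Ax ψ) ∧
      ∀ v, (∀ ψ ∈ l, evalP v ψ) → evalP v φ :=
  exists_list_of_entails (S := {ψ | ψ ∈ Γ ∨ Prv Ax ψ}) fun v hv =>
    h ⟨v, fun ψ hψ => hv ψ (.inr hψ)⟩ fun ψ hψ => hv ψ (.inl hψ)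

theorem deduces_of_worlds {Γ : Set (Form I)} {φ : Form I}
    (h : ∀ w : World Ax, (∀ ψ ∈ Γ, w.Holds ψ) → w.Holds φ) : Deduces Ax Γ φ := by
  obtain ⟨l, hl, hφ⟩ := exists_list_of_worlds h
  exact deduces_of_list l hl φ hφ

theorem prv_of_worlds {φ : Form I} (h : ∀ w : World Ax, w.Holds φ) : Prv Ax φ := by
  obtain ⟨l, hl, hp⟩ := deduces_of_worlds (Γ := ∅) fun w _ => h w
  exact .mp hp (.taut fun v => by
    rw [evalP_foldr_and]
    exact ⟨fun ψ hψ => absurd (hl ψ hψ) (by simp), evalP_top v⟩)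

namespace World

variable (w : World Ax)

@[simp] theorem holds_or (φ ψ : Form I) : w.Holds (φ.or ψ) ↔ w.Holds φ ∨ w.Holds ψ :=
  Iff.rfl

theorem holds_of_imp_ax {φ ψ χ : Form I} (h : (φ.and ψ).imp χ ∈ Ax)
    (hφ : w.Holds φ) (hψ : w.Holds ψ) : w.Holds χ :=
  (evalP_imp _ _ _).1 (w.2 _ (.ax h)) ((evalP_and _ _ _).2 ⟨hφ, hψ⟩)

theorem holds_box_congr {G : Finset I} {hG : G.Nonempty} {φ ψ : Form I}
    (h : ∀ u : World Ax, u.Holds φ ↔ u.Holds ψ) :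
    w.Holds (.box G hG φ) ↔ w.Holds (.box G hG ψ) :=
  (evalP_iff _ _ _).1 (w.2 _ (.re G hG (prv_of_worlds fun u => (evalP_iff _ _ _).2 (h u))))

theorem holds_box_index {G H : Finset I} {hG : G.Nonempty} {hH : H.Nonempty} {φ : Form I}
    (h : G = H) : w.Holds (.box G hG φ) ↔ w.Holds (.box H hH φ) := by
  subst h; rfl

end World

end Worlds

section Canonical

variable [DecidableEq I]

/-- The system with unrestricted aggregation. -/
abbrev CGSystem (I : Type) [DecidableEq I] : Set (Form I) :=
  CGAx I ∪ B2Ax I ∪ B3Ax I ∪ B4Ax I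

variable (w : World (CGSystem I))

theorem holds_box_union {G H : Finset I} {hG : G.Nonempty} {hH : H.Nonempty} {φ ψ : Form I}
    (h₁ : w.Holds (.box G hG φ)) (h₂ : w.Holds (.box H hH ψ)) :
    w.Holds (.box (G ∪ H) (unionNE hG) (φ.and ψ)) :=
  w.holds_of_imp_ax (.inl (.inl (.inl ⟨G, H, hG, hH, φ, ψ, rfl⟩))) h₁ h₂

theorem holds_box_top_of_subset {G K : Finset I} {hG : G.Nonempty} {hK : K.Nonempty}
    (hGK : G ⊆ K) (h : w.Holds (.box K hK .top)) : w.Holds (.box G hG .top) :=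
  (evalP_imp _ _ _).1 (w.2 _ (.ax (.inl (.inl (.inr ⟨G, K, hG, hK, rfl⟩)))))
    ((w.holds_box_index (Finset.union_eq_right.2 hGK).symm).1 h)

theorem holds_box_of_between {U G K : Finset I} {hU : U.Nonempty} {hG : G.Nonempty}
    {hK : K.Nonempty} {φ : Form I} (hUG : U ⊆ G) (hGK : G ⊆ K)
    (h₁ : w.Holds (.box U hU φ)) (h₂ : w.Holds (.box K hK φ)) : w.Holds (.box G hG φ) := by
  refine (w.holds_box_index (Finset.union_eq_right.2 hUG)).1
    (w.holds_of_imp_ax (.inl (.inr ⟨U, G, K, hU, hG, hK, φ, rfl⟩)) h₁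
      ((w.holds_box_index ?_).1 h₂))
  rw [Finset.union_eq_right.2 hUG, Finset.union_eq_right.2 hGK]

theorem holds_box_union_of_imp {G H : Finset I} {hG : G.Nonempty} {hH : H.Nonempty}
    {φ ψ : Form I} (h : ∀ u : World (CGSystem I), u.Holds φ → u.Holds ψ)
    (h₁ : w.Holds (.box G hG φ)) (h₂ : w.Holds (.box H hH ψ)) :
    w.Holds (.box (G ∪ H) (unionNE hG) φ) :=
  w.holds_of_imp_ax (.inr ⟨G, H, hG, hH, φ, ψ, rfl⟩) h₁
    ((w.holds_box_congr fun u => by simpa using h u).1 h₂)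

theorem exists_box_foldr {G H₀ : Finset I} (hH₀ : H₀.Nonempty) (hH₀G : H₀ ⊆ G) {φ₀ : Form I}
    (h₀ : w.Holds (.box H₀ hH₀ φ₀)) (l : List (Form I))
    (hl : ∀ φ ∈ l, ∃ (H : Finset I) (hH : H.Nonempty), H ⊆ G ∧ w.Holds (.box H hH φ)) :
    ∃ (U : Finset I) (hU : U.Nonempty), U ⊆ G ∧ w.Holds (.box U hU (l.foldr Form.and φ₀)) := by
  induction l with
  | nil => exact ⟨H₀, hH₀, hH₀G, h₀⟩
  | cons φ l ih =>
    obtain ⟨U, hU, hUG, hb⟩ := ih fun χ hχ => hl χ (List.mem_cons_of_mem _ hχ)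
    obtain ⟨H, hH, hHG, hb'⟩ := hl φ List.mem_cons_self
    exact ⟨H ∪ U, unionNE hH, Finset.union_subset hHG hUG, holds_box_union w hb' hb⟩

theorem exists_box_superset {U : Finset I} (hU : U.Nonempty) {ψ : Form I}
    (hb : w.Holds (.box U hU ψ)) (T : Finset I)
    (hT : ∀ i ∈ T, ∃ (H : Finset I) (hH : H.Nonempty) (φ : Form I), i ∈ H ∧
      w.Holds (.box H hH φ) ∧ ∀ u : World (CGSystem I), u.Holds ψ → u.Holds φ) :
    ∃ (K : Finset I) (hK : K.Nonempty), T ⊆ K ∧ w.Holds (.box K hK ψ) := by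
  induction T using Finset.induction_on with
  | empty => exact ⟨U, hU, Finset.empty_subset _, hb⟩
  | insert i T _ ih =>
    obtain ⟨K, hK, hTK, hbK⟩ := ih fun j hj => hT j (Finset.mem_insert_of_mem hj)
    obtain ⟨H, hH, φ, hiH, hbH, himp⟩ := hT i (Finset.mem_insert_self _ _)
    refine ⟨K ∪ H, unionNE hK, ?_, holds_box_union_of_imp w himp hbK hbH⟩
    exact Finset.insert_subset (Finset.mem_union_right _ hiH)
      (hTK.trans Finset.subset_union_left)

/-- Boxed formulas, given by their group and their body. -/
abbrev BoxIdx (I : Type) : Type := {G : Finset I // G.Nonempty} × Form I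

/-- A choice of one member of the group of each boxed formula. -/
abbrev Choice (I : Type) : Type := (p : BoxIdx I) → {i : I // i ∈ p.1.1}

instance : Nonempty (Choice I) :=
  ⟨fun p => ⟨p.1.2.choose, p.1.2.choose_spec⟩⟩

/-- The neighbourhood contributed to agent `i` by the boxed formula `p`: the points satisfying
the body of `p`, or else blaming an agent other than `i`. -/
def generator (i : I) (p : BoxIdx I) : Set (World (CGSystem I) × Choice I) :=
  {x | x.1.Holds p.2 ∨ (x.2 p).1 ≠ i}

/-- The boxed formulas that hold at `w` and involve agent `i`. -/
def activeBoxes (i : I) : Set (BoxIdx I) :=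
  {p | i ∈ p.1.1 ∧ w.Holds (.box p.1.1 p.1.2 p.2)}

/-- The canonical neighbourhoods: nonempty intersections of generators. -/
def canonicalNbh (i : I) (x : World (CGSystem I) × Choice I) :
    Set (Set (World (CGSystem I) × Choice I)) :=
  {X | ∃ A ⊆ activeBoxes x.1 i, A.Nonempty ∧ X = ⋂ p ∈ A, generator i p}

theorem canonicalNbh_sInter_mem (i : I) (x : World (CGSystem I) × Choice I)
    {Y : Set (Set (World (CGSystem I) × Choice I))} (hY : Y ⊆ canonicalNbh i x)
    (hne : Y.Nonempty) : ⋂₀ Y ∈ canonicalNbh i x := by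
  refine ⟨{p ∈ activeBoxes x.1 i | ⋂₀ Y ⊆ generator i p}, fun p hp => hp.1, ?_, ?_⟩
  · obtain ⟨X, hX⟩ := hne
    obtain ⟨A, hA, ⟨p, hp⟩, rfl⟩ := hY hX
    exact ⟨p, hA hp, (Set.sInter_subset_of_mem hX).trans (Set.biInter_subset_of_mem hp)⟩
  · refine Set.Subset.antisymm (Set.subset_iInter₂ fun p hp => hp.2)
      (Set.subset_sInter fun X hX => ?_)
    obtain ⟨A, hA, -, rfl⟩ := hY hX
    exact Set.subset_iInter₂ fun p hp => Set.biInter_subset_of_mem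
      ⟨hA hp, (Set.sInter_subset_of_mem hX).trans (Set.biInter_subset_of_mem hp)⟩

theorem mem_ptwInter_canonicalNbh_of_holds {x : World (CGSystem I) × Choice I} {G : Finset I}
    {hG : G.Nonempty} {ψ : Form I} (h : x.1.Holds (.box G hG ψ)) :
    {y : World (CGSystem I) × Choice I | y.1.Holds ψ} ∈ ptwInter canonicalNbh G x := by
  refine ⟨fun i => generator i (⟨G, hG⟩, ψ), fun i hi => ⟨{(⟨G, hG⟩, ψ)}, ?_, by simp, by simp⟩, ?_⟩
  · rintro _ rfl
    exact ⟨hi, h⟩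
  · ext y
    simp only [Set.mem_ofPred_eq, Set.mem_iInter, generator]
    exact ⟨fun hy _ _ => .inl hy, fun hy =>
      (hy _ (y.2 (⟨G, hG⟩, ψ)).2).resolve_right fun hne => hne rfl⟩

theorem holds_of_mem_ptwInter_canonicalNbh {x : World (CGSystem I) × Choice I} {G : Finset I}
    {hG : G.Nonempty} {ψ : Form I}
    (h : {y : World (CGSystem I) × Choice I | y.1.Holds ψ} ∈ ptwInter canonicalNbh G x) :
    x.1.Holds (.box G hG ψ) := by
  obtain ⟨Y, hY, heq⟩ := h
  choose! A hA hAne hYA using hY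
  have hmem (y : World (CGSystem I) × Choice I) :
      y.1.Holds ψ ↔ ∀ i ∈ G, ∀ p ∈ A i, y.1.Holds p.2 ∨ (y.2 p).1 ≠ i := by
    have hy := Set.ext_iff.1 heq y
    simp only [Set.mem_ofPred_eq, Set.mem_iInter] at hy
    rw [hy]
    refine forall₂_congr fun i hi => ?_
    rw [hYA i hi]
    simp [generator]
  -- every contributing formula follows from `ψ`
  have himp (i : I) (hi : i ∈ G) (p : BoxIdx I) (hp : p ∈ A i) (u : World (CGSystem I))
      (hu : u.Holds ψ) : u.Holds p.2 := by
    let f : Choice I := Function.update (Classical.arbitrary _) p ⟨i, (hA i hi hp).1⟩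
    exact ((hmem (u, f)).1 hu i hi p hp).resolve_right (by simp [f])
  -- the boxed formulas contributing to every member of their group jointly imply `ψ`
  let C : Set (BoxIdx I) := {p | ∀ i ∈ p.1.1, i ∈ G ∧ p ∈ A i}
  have hC (u : World (CGSystem I)) (hu : ∀ p ∈ C, u.Holds p.2) : u.Holds ψ := by
    have hex (p : BoxIdx I) : ∃ j : {j : I // j ∈ p.1.1}, p ∉ C → ¬ (j.1 ∈ G ∧ p ∈ A j.1) := by
      by_cases hp : p ∈ C
      · exact ⟨⟨_, p.1.2.choose_spec⟩, fun h => absurd hp h⟩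
      · simp only [C, Set.mem_ofPred_eq, not_forall] at hp
        obtain ⟨j, hj, hj'⟩ := hp
        exact ⟨⟨j, hj⟩, fun _ => hj'⟩
    choose f hf using hex
    refine (hmem (u, f)).2 fun i hi p hp => ?_
    by_cases hpC : p ∈ C
    · exact .inl (hu p hpC)
    · refine .inr ?_
      rintro rfl
      exact hf p hpC ⟨hi, hp⟩
  have hCbox (p : BoxIdx I) (hp : p ∈ C) :
      p.1.1 ⊆ G ∧ x.1.Holds (.box p.1.1 p.1.2 p.2) := by
    refine ⟨fun i hi => (hp i hi).1, ?_⟩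
    obtain ⟨i, hi⟩ := p.1.2
    exact (hA i (hp i hi).1 (hp i hi).2).2
  have hlower : ∃ (U : Finset I) (hU : U.Nonempty), U ⊆ G ∧ x.1.Holds (.box U hU ψ) := by
    rcases C.eq_empty_or_nonempty with hCe | ⟨p₀, hp₀⟩
    · have hψ (u : World (CGSystem I)) : u.Holds ψ := hC u (by simp [hCe])
      obtain ⟨i, hi⟩ := hG
      obtain ⟨p, hp⟩ := hAne i hi
      obtain ⟨hip, hbp⟩ := hA i hi hp
      have htop : x.1.Holds (.box p.1.1 p.1.2 .top) := (x.1.holds_box_congr fun u =>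
        ⟨fun _ => evalP_top _, fun _ => himp i hi p hp u (hψ u)⟩).1 hbp
      refine ⟨{i}, Finset.singleton_nonempty i, Finset.singleton_subset_iff.2 hi, ?_⟩
      exact (x.1.holds_box_congr fun u => ⟨fun _ => hψ u, fun _ => evalP_top _⟩).1
        (holds_box_top_of_subset x.1 (Finset.singleton_subset_iff.2 hip) htop)
    · obtain ⟨l, hl, hlψ⟩ := exists_list_of_worlds (Ax := CGSystem I)
        (Γ := Prod.snd '' C) (φ := ψ) fun u hu => hC u fun p hp => hu _ ⟨p, hp, rfl⟩
      classical
      let l' := l.filter fun χ => χ ∈ Prod.snd '' C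
      obtain ⟨U, hU, hUG, hb⟩ := exists_box_foldr x.1 p₀.1.2 (hCbox p₀ hp₀).1
        (hCbox p₀ hp₀).2 l' (by
          intro χ hχ
          obtain ⟨p, hp, rfl⟩ : χ ∈ Prod.snd '' C := by
            simpa using (List.mem_filter.1 hχ).2
          exact ⟨p.1.1, p.1.2, hCbox p hp⟩)
      refine ⟨U, hU, hUG, (x.1.holds_box_congr fun u => ?_).1 hb⟩
      have hCψ (p : BoxIdx I) (hp : p ∈ C) (hu : u.Holds ψ) : u.Holds p.2 := by
        obtain ⟨i, hi⟩ := p.1.2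
        exact himp i (hp i hi).1 p (hp i hi).2 u hu
      refine (evalP_foldr_and _ _ _).trans ⟨fun hu => hlψ _ fun χ hχ => ?_, fun hu => ⟨?_, ?_⟩⟩
      · by_cases hχC : χ ∈ Prod.snd '' C
        · exact hu.1 χ (List.mem_filter.2 ⟨hχ, by simpa using hχC⟩)
        · exact u.2 χ ((hl χ hχ).resolve_left hχC)
      · intro χ hχ
        obtain ⟨p, hp, rfl⟩ : χ ∈ Prod.snd '' C := by
          simpa using (List.mem_filter.1 hχ).2
        exact hCψ p hp hu
      · exact hCψ p₀ hp₀ hu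
  obtain ⟨U, hU, hUG, hb⟩ := hlower
  obtain ⟨K, hK, hGK, hbK⟩ := exists_box_superset x.1 hU hb G fun i hi => by
    obtain ⟨p, hp⟩ := hAne i hi
    exact ⟨p.1.1, p.1.2, p.2, (hA i hi hp).1, (hA i hi hp).2, himp i hi p hp⟩
  exact holds_box_of_between x.1 hUG hGK hb hbK

/-- The canonical valuation. -/
def canonicalVal (n : ℕ) : Set (World (CGSystem I) × Choice I) :=
  {x | x.1.Holds (.atom n)}

theorem satN_canonical_iff (φ : Form I) (x : World (CGSystem I) × Choice I) :
    satN canonicalNbh canonicalVal φ x ↔ x.1.Holds φ := by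
  induction φ generalizing x with
  | atom n => rfl
  | bot => rfl
  | neg φ ih => exact not_congr (ih x)
  | or φ ψ ih₁ ih₂ => exact or_congr (ih₁ x) (ih₂ x)
  | box G hG φ ih =>
    simp only [satN, ih]
    exact ⟨holds_of_mem_ptwInter_canonicalNbh, mem_ptwInter_canonicalNbh_of_holds⟩

end Canonical

section Soundness

variable {W : Type} {N : I → W → Set (Set W)} {V : ℕ → Set W} {w : W}

theorem evalP_satN_iff (φ : Form I) : evalP (fun χ => satN N V χ w) φ ↔ satN N V φ w := by
  induction φ with
  | neg φ ih => exact not_congr ih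
  | or φ ψ ih₁ ih₂ => exact or_congr ih₁ ih₂
  | _ => rfl

@[simp] theorem satN_and (φ ψ : Form I) :
    satN N V (φ.and ψ) w ↔ satN N V φ w ∧ satN N V ψ w := by
  rw [← evalP_satN_iff, evalP_and, evalP_satN_iff, evalP_satN_iff]

@[simp] theorem satN_imp (φ ψ : Form I) :
    satN N V (φ.imp ψ) w ↔ (satN N V φ w → satN N V ψ w) := by
  rw [← evalP_satN_iff, evalP_imp, evalP_satN_iff, evalP_satN_iff]

@[simp] theorem satN_iff (φ ψ : Form I) :
    satN N V (φ.iff ψ) w ↔ (satN N V φ w ↔ satN N V ψ w) := by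
  rw [← evalP_satN_iff, evalP_iff, evalP_satN_iff, evalP_satN_iff]

variable {G H : Finset I}

theorem inter_mem_ptwInter_union [DecidableEq I]
    (hN : ∀ i, ∀ X ∈ N i w, ∀ Y ∈ N i w, X ∩ Y ∈ N i w)
    {X Y : Set W} (hX : X ∈ ptwInter N G w) (hY : Y ∈ ptwInter N H w) :
    X ∩ Y ∈ ptwInter N (G ∪ H) w := by
  obtain ⟨A, hA, rfl⟩ := hX
  obtain ⟨B, hB, rfl⟩ := hY
  refine ⟨fun i => if i ∈ G then if i ∈ H then A i ∩ B i else A i else B i, ?_, ?_⟩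
  · intro i hi
    by_cases hG : i ∈ G <;> by_cases hH : i ∈ H <;> simp_all
  · ext y
    simp only [Set.mem_inter_iff, Set.mem_iInter, Finset.mem_union]
    constructor
    · rintro ⟨h₁, h₂⟩ i hi
      by_cases hG : i ∈ G <;> by_cases hH : i ∈ H <;> simp_all
    · intro h
      refine ⟨fun i hi => ?_, fun i hi => ?_⟩
      · have := h i (.inl hi)
        by_cases hH : i ∈ H <;> simp_all
      · have := h i (.inr hi)
        by_cases hG : i ∈ G <;> simp_all

theorem univ_mem_ptwInter_of_subset (hGH : G ⊆ H)
    (h : Set.univ ∈ ptwInter N H w) : Set.univ ∈ ptwInter N G w := by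
  obtain ⟨A, hA, hU⟩ := h
  exact ⟨A, fun i hi => hA i (hGH hi),
    (Set.univ_subset_iff.1 (hU.trans_subset (Set.biInter_mono hGH fun _ _ => subset_rfl))).symm⟩

theorem mem_ptwInter_of_between {K : Finset I} (hGH : G ⊆ H) (hHK : H ⊆ K) {X : Set W}
    (h₁ : X ∈ ptwInter N G w) (h₂ : X ∈ ptwInter N K w) : X ∈ ptwInter N H w := by
  obtain ⟨A, hA, hXA⟩ := h₁
  obtain ⟨B, hB, hXB⟩ := h₂
  classical
  refine ⟨fun i => if i ∈ G then A i else B i, fun i hi => ?_, Set.Subset.antisymm ?_ ?_⟩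
  · by_cases hG : i ∈ G
    · simpa [hG] using hA i hG
    · simpa [hG] using hB i (hHK hi)
  · refine Set.subset_iInter₂ fun i hi => ?_
    by_cases hG : i ∈ G
    · simpa [hG] using hXA.trans_subset (Set.biInter_subset_of_mem hG)
    · simpa [hG] using hXB.trans_subset (Set.biInter_subset_of_mem (hHK hi))
  · rw [hXA]
    refine Set.subset_iInter₂ fun i hi => ?_
    have := Set.biInter_subset_of_mem (t := fun i => if i ∈ G then A i else B i) (hGH hi)
    simpa [hi] using this

theorem satN_of_prv [DecidableEq I]
    (hN : ∀ i w, ∀ X ∈ N i w, ∀ Y ∈ N i w, X ∩ Y ∈ N i w) {φ : Form I}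
    (h : Prv (CGSystem I) φ) (w : W) : satN N V φ w := by
  induction h generalizing w with
  | taut h => exact (evalP_satN_iff _).1 (h _)
  | mp _ _ ih₁ ih₂ => exact (satN_imp _ _).1 (ih₁ w) (ih₂ w)
  | re G hG _ ih =>
    simp only [satN_iff] at ih
    simp only [satN_iff, satN, ih]
  | ax h =>
    rcases h with ((⟨G, H, hG, hH, φ, ψ, rfl⟩ | ⟨G, H, hG, hH, rfl⟩) |
      ⟨G, H, J, hG, hH, hJ, φ, rfl⟩) | ⟨G, H, hG, hH, φ, ψ, rfl⟩
    · simp only [satN_imp, satN_and, satN]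
      exact fun h => inter_mem_ptwInter_union (fun i => hN i w) h.1 h.2
    · simp only [satN_imp, satN, Form.top, not_false_eq_true, Set.ofPred_true]
      exact univ_mem_ptwInter_of_subset Finset.subset_union_left
    · simp only [satN_imp, satN_and, satN]
      exact fun h => mem_ptwInter_of_between Finset.subset_union_left Finset.subset_union_left
        h.1 h.2
    · simp only [satN_imp, satN_and, satN]
      intro h
      have := inter_mem_ptwInter_union (fun i => hN i w) h.1 h.2
      rwa [Set.inter_eq_left.2 (show {v | satN N V φ v} ⊆ {v | satN N V φ v ∨ satN N V ψ v} from
        fun v hv => Or.inl hv)] at this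

end Soundness

end NbhLogic

open NbhLogic

/-- The system obtained from the base logic by replacing B1
with its unrestricted counterpart (C_G) is sound and strongly complete
w.r.t. the class of models in which each N_i(w) is closed under arbitrary
(nonempty) intersections. -/
theorem CG_arbitrary_inter_sound_complete (I : Type) [DecidableEq I] :
    SoundComplete (CGAx I ∪ B2Ax I ∪ B3Ax I ∪ B4Ax I)
      (fun M : NbhModel I => ∀ (i : I) (w : M.W) (Y : Set (Set M.W)),
        Y ⊆ M.N i w → Y.Nonempty → ⋂₀ Y ∈ M.N i w) := by
  refine fun Γ φ => ⟨?_, fun h => deduces_of_worlds fun w hw => ?_⟩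
  · rintro ⟨l, hl, hp⟩ M hM w hw
    have hN (i : I) (w : M.W) (X : Set M.W) (hX : X ∈ M.N i w) (Y : Set M.W)
        (hY : Y ∈ M.N i w) : X ∩ Y ∈ M.N i w := by
      rw [← Set.sInter_pair]
      exact hM i w _ (Set.pair_subset hX hY) (Set.insert_nonempty _ _)
    refine (satN_imp _ _).1 (satN_of_prv hN hp w) ?_
    rw [← evalP_satN_iff, evalP_foldr_and]
    exact ⟨fun ψ hψ => (evalP_satN_iff ψ).2 (hw ψ (hl ψ hψ)), evalP_top _⟩
  · let x : World (CGSystem I) × Choice I := (w, Classical.arbitrary _)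
    exact (satN_canonical_iff φ x).1 (h ⟨_, ⟨x⟩, canonicalNbh, canonicalVal⟩
      (fun i y _ => canonicalNbh_sInter_mem i y) x
      fun ψ hψ => (satN_canonical_iff ψ x).2 (hw ψ hψ))
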